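/- arXiv:1506.07658 — 15 statements merged into one kernel-verified Lean document; each statement's English description precedes it below -/
import Mathlib

section
/- Let M be a monoid and v : ι → M a family of elements that half-commute, i.e. v i * v j * v k = v k * v j * v i for all i, j, k ∈ ι. Then for all i, j, k, l ∈ ι the products of length two commute: (v i * v j) * (v k * v l) = (v k * v l) * (v i * v j). -/
/-- If the elements of a family `v` in a monoid half-commute
(`v i * v j * v k = v k * v j * v i`), then the length-two products `v i * v j`
pairwise commute. -/
theorem stmt2 {M : Type*} [Monoid M] {ι : Type*} (v : ι → M)
    (hhalf : ∀ i j k, v i * v j * v k = v k * v j * v i) (i j k l : ι) :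
    (v i * v j) * (v k * v l) = (v k * v l) * (v i * v j) := by
  calc (v i * v j) * (v k * v l) = (v i * v j * v k) * v l := by simp only [mul_assoc]
    _ = (v k * v j * v i) * v l := by rw [hhalf i j k]
    _ = v k * (v j * v i * v l) := by simp only [mul_assoc]
    _ = v k * (v l * v i * v j) := by rw [hhalf j i l]
    _ = (v k * v l) * (v i * v j) := by simp only [mul_assoc]
end

section
/- Let A be a ring (with unit), n ≥ 1, and v : Fin n → A a family satisfying v i * v j * v k = v k * v j * v i for all i, j, k, and ∑_{k} (v k)² = 1. Then for every m ≥ 1 and every list of index pairs (i₁, j₁), …, (i_m, j_m) in Fin n: ∑_{k} v k * (v i₁ * v j₁ * ⋯ * v i_m * v j_m) * v k = v j₁ * v i₁ * ⋯ * v j_m * v i_m, i.e. the map γ(a) = ∑_k v k · a · v k sends each even word to the word obtained by swapping each consecutive pair of letters. -/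
/-- Let `v : Fin n → A` be half-commuting self-adjoint-style generators of a ring with
`∑ k, (v k)² = 1`.  Then the map `γ(a) = ∑ k, v k * a * v k` sends every nonempty even
word `v i₁ * v j₁ * ⋯ * v i_m * v j_m` to the word `v j₁ * v i₁ * ⋯ * v j_m * v i_m`
obtained by swapping each consecutive pair of letters. -/
theorem stmt3 {A : Type*} [Ring A] (n : ℕ) (hn : 1 ≤ n) (v : Fin n → A)
    (hhalf : ∀ i j k, v i * v j * v k = v k * v j * v i)
    (hsum : ∑ k, v k * v k = 1)
    (L : List (Fin n × Fin n)) (hL : L ≠ []) :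
    ∑ k, v k * (L.map fun p => v p.1 * v p.2).prod * v k
      = (L.map fun p => v p.2 * v p.1).prod := by
  have key : ∀ (k : Fin n) (L : List (Fin n × Fin n)),
      v k * (L.map fun p => v p.1 * v p.2).prod
        = (L.map fun p => v p.2 * v p.1).prod * v k := by
    intro k L
    induction L with
    | nil => simp
    | cons p L ih =>
      simp only [List.map_cons, List.prod_cons]
      rw [← mul_assoc, ← mul_assoc, hhalf k p.1 p.2, mul_assoc _ (v k), ih, ← mul_assoc]
  simp only [key, mul_assoc]
  rw [← Finset.mul_sum, hsum, mul_one]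
end

section
/- Let M be a monoid and v : ι → M a family satisfying v i * v j * v k = v k * v j * v i for all i, j, k ∈ ι. Then for every index k, every m ≥ 1 and every list of index pairs (i₁, j₁), …, (i_m, j_m): v k * (v i₁ * v j₁ * ⋯ * v i_m * v j_m) = (v j₁ * v i₁ * ⋯ * v j_m * v i_m) * v k. -/
/-- If the elements of a family `v` in a monoid half-commute, then for every index `k`
and every nonempty even word one has
`v k * (v i₁ * v j₁ * ⋯ * v i_m * v j_m) = (v j₁ * v i₁ * ⋯ * v j_m * v i_m) * v k`. -/
theorem stmt4 {M : Type*} [Monoid M] {ι : Type*} (v : ι → M)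
    (hhalf : ∀ i j k, v i * v j * v k = v k * v j * v i)
    (k : ι) (L : List (ι × ι)) (hL : L ≠ []) :
    v k * (L.map fun p => v p.1 * v p.2).prod
      = (L.map fun p => v p.2 * v p.1).prod * v k := by
  clear hL
  induction L with
  | nil => simp
  | cons p L ih =>
    simp only [List.map_cons, List.prod_cons]
    rw [← mul_assoc, ← mul_assoc (v k), hhalf k p.1 p.2, mul_assoc, ih, ← mul_assoc]
end

section
/- Let Z be a compact Hausdorff space with a continuous free action of the circle group 𝕋 = {ω ∈ ℂ : |ω| = 1} (ω • z = z implies ω = 1). Then for every z ∈ Z there exists a continuous function f : Z → ℂ such that f(ω • y) = ω · f(y) for all ω ∈ 𝕋, y ∈ Z, and f(z) = 1. -/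
theorem stmt5 {Z : Type*} [TopologicalSpace Z] [CompactSpace Z] [T2Space Z]
    [MulAction Circle Z] [ContinuousSMul Circle Z]
    (hfree : ∀ (ω : Circle) (z : Z), ω • z = z → ω = 1) (z : Z) :
    ∃ f : C(Z, ℂ), (∀ (ω : Circle) (y : Z), f (ω • y) = (ω : ℂ) * f y) ∧ f z = 1 := by
  have hinj : Function.Injective (fun ω : Circle => ω • z) := by
    intro a b hab
    have h : (b⁻¹ * a) • z = z := by
      rw [mul_smul]
      simp only at hab
      rw [hab, inv_smul_smul]
    exact (inv_mul_eq_one.mp (hfree _ _ h)).symm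
  have hce : Topology.IsClosedEmbedding (fun ω : Circle => ω • z) :=
    Continuous.isClosedEmbedding (by fun_prop) hinj
  obtain ⟨g, hg⟩ := ContinuousMap.exists_extension' hce
    (⟨fun ω : Circle => (ω : ℂ), by fun_prop⟩ : C(Circle, ℂ))
  have hg' : ∀ ω : Circle, g (ω • z) = ω := fun ω => congrFun hg ω
  letI : MeasurableSpace Circle := borel Circle
  haveI : BorelSpace Circle := ⟨rfl⟩
  let μ : MeasureTheory.Measure Circle :=
    MeasureTheory.Measure.haarMeasure (⊤ : TopologicalSpace.PositiveCompacts Circle)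
  have hμ : μ Set.univ = 1 := by
    simpa using MeasureTheory.Measure.haarMeasure_self
      (K₀ := (⊤ : TopologicalSpace.PositiveCompacts Circle))
  haveI : MeasureTheory.IsProbabilityMeasure μ := ⟨hμ⟩
  have hcont : Continuous (fun y : Z => ∫ ω : Circle, ((ω⁻¹ : Circle) : ℂ) * g (ω • y) ∂μ) := by
    rw [← continuousOn_univ]
    refine continuousOn_integral_of_compact_support (k := Set.univ) isCompact_univ ?_ ?_
    · apply Continuous.continuousOn
      simp only [Function.uncurry_def]
      fun_prop
    · intro p x _ hx
      exact absurd (Set.mem_univ x) hx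
  refine ⟨⟨_, hcont⟩, ?_, ?_⟩
  · intro η y
    simp only [ContinuousMap.coe_mk]
    rw [← MeasureTheory.integral_const_mul,
      ← MeasureTheory.integral_mul_right_eq_self
        (fun ω : Circle => (η : ℂ) * (((ω⁻¹ : Circle) : ℂ) * g (ω • y))) η]
    congr 1
    ext ω
    rw [mul_smul, ← mul_assoc, ← Circle.coe_mul, mul_inv_rev, mul_inv_cancel_left]
  · simp only [ContinuousMap.coe_mk, hg', ← Circle.coe_mul, inv_mul_cancel, Circle.coe_one]
    simp
end

section
/- The set S is a unital star-subalgebra of the C*-algebra C(Z, M₂(ℂ)) of continuous M₂(ℂ)-valued functions on Z (it contains the constant identity, and is closed under addition, scalar multiplication, multiplication and the pointwise conjugate-transpose involution), and S is closed in the uniform topology of C(Z, M₂(ℂ)). -/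
/-- The set `S` of continuous `M₂(ℂ)`-valued functions
`z ↦ !![f₀ z, f₁ z; f₁ (τ z), f₀ (τ z)]`, with `f₀` a `𝕋`-invariant and `f₁` a
`𝕋`-equivariant continuous function, is a unital star-subalgebra of `C(Z, M₂(ℂ))`,
closed in the uniform topology. -/
theorem stmt8 {Z : Type*} [TopologicalSpace Z] [CompactSpace Z] [T2Space Z]
    [MulAction Circle Z] [ContinuousSMul Circle Z]
    (τ : C(Z, Z)) (hττ : ∀ z, τ (τ z) = z)
    (hτsmul : ∀ (ω : Circle) (z : Z), τ (ω • z) = ω⁻¹ • τ z)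
    (S : Set C(Z, Matrix (Fin 2) (Fin 2) ℂ))
    (hS : ∀ F, F ∈ S ↔ ∃ f₀ f₁ : C(Z, ℂ),
        (∀ (ω : Circle) (z : Z), f₀ (ω • z) = f₀ z) ∧
        (∀ (ω : Circle) (z : Z), f₁ (ω • z) = (ω : ℂ) * f₁ z) ∧
        ∀ z, F z = !![f₀ z, f₁ z; f₁ (τ z), f₀ (τ z)]) :
    (1 : C(Z, Matrix (Fin 2) (Fin 2) ℂ)) ∈ S ∧
    (∀ F ∈ S, ∀ G ∈ S, F + G ∈ S) ∧
    (∀ (c : ℂ), ∀ F ∈ S, c • F ∈ S) ∧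
    (∀ F ∈ S, ∀ G ∈ S, F * G ∈ S) ∧
    (∀ F ∈ S, star F ∈ S) ∧
    IsClosed S := by
  have hone : ∀ ω : Circle, (ω : ℂ) ≠ 0 := fun ω => Circle.coe_ne_zero ω
  have hS' : ∀ F, F ∈ S ↔ (∀ (ω : Circle) (z : Z), F (ω • z) 0 0 = F z 0 0) ∧
      (∀ (ω : Circle) (z : Z), F (ω • z) 0 1 = (ω : ℂ) * F z 0 1) ∧
      (∀ z, F z 1 0 = F (τ z) 0 1) ∧ (∀ z, F z 1 1 = F (τ z) 0 0) := by
    intro F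
    rw [hS]
    constructor
    · rintro ⟨f₀, f₁, h0, h1, h⟩
      refine ⟨?_, ?_, ?_, ?_⟩ <;> intros <;> simp [h, h0, h1]
    · rintro ⟨h0, h1, h2, h3⟩
      refine ⟨⟨fun z => F z 0 0, by fun_prop⟩, ⟨fun z => F z 0 1, by fun_prop⟩, h0, h1, ?_⟩
      intro z
      ext i j
      fin_cases i <;> fin_cases j <;> simp [h2, h3]
  refine ⟨?_, ?_, ?_, ?_, ?_, ?_⟩
  · rw [hS']
    simp
  · intro F hF G hG
    rw [hS'] at *
    obtain ⟨a, b, c, d⟩ := hF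
    obtain ⟨a', b', c', d'⟩ := hG
    refine ⟨?_, ?_, ?_, ?_⟩ <;> intros <;>
      simp only [ContinuousMap.add_apply, Matrix.add_apply, a, b, c, d, a', b', c', d'] <;> ring
  · intro k F hF
    rw [hS'] at *
    obtain ⟨a, b, c, d⟩ := hF
    refine ⟨?_, ?_, ?_, ?_⟩ <;> intros <;>
      simp only [ContinuousMap.smul_apply, Matrix.smul_apply, smul_eq_mul, a, b, c, d] <;> ring
  · intro F hF G hG
    rw [hS'] at *
    obtain ⟨a, b, c, d⟩ := hF
    obtain ⟨a', b', c', d'⟩ := hG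
    refine ⟨?_, ?_, ?_, ?_⟩ <;> intros <;>
      simp only [ContinuousMap.mul_apply, Matrix.mul_apply, Fin.sum_univ_two,
        a, b, c, d, a', b', c', d', hτsmul, hττ, Circle.coe_inv] <;>
      first
        | ring1
        | (field_simp)
  · intro F hF
    rw [hS'] at *
    obtain ⟨a, b, c, d⟩ := hF
    refine ⟨?_, ?_, ?_, ?_⟩ <;> intros <;>
      simp [Matrix.star_apply, a, b, c, d, hτsmul, hττ, ← Circle.coe_inv_eq_conj]
  · have hev : ∀ (z : Z) (i j : Fin 2),
        Continuous fun F : C(Z, Matrix (Fin 2) (Fin 2) ℂ) => F z i j := fun z i j =>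
      (continuous_eval_const z).matrix_elem i j
    have : S = {F | (∀ (ω : Circle) (z : Z), F (ω • z) 0 0 = F z 0 0) ∧
      (∀ (ω : Circle) (z : Z), F (ω • z) 0 1 = (ω : ℂ) * F z 0 1) ∧
      (∀ z, F z 1 0 = F (τ z) 0 1) ∧ (∀ z, F z 1 1 = F (τ z) 0 0)} := Set.ext hS'
    rw [this]
    simp only [Set.setOf_and, Set.setOf_forall]
    refine IsClosed.inter ?_ (IsClosed.inter ?_ (IsClosed.inter ?_ ?_))
    · exact isClosed_iInter fun ω => isClosed_iInter fun z => isClosed_eq (hev _ _ _) (hev _ _ _)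
    · exact isClosed_iInter fun ω => isClosed_iInter fun z =>
        isClosed_eq (hev _ _ _) (continuous_const.mul (hev _ _ _))
    · exact isClosed_iInter fun z => isClosed_eq (hev _ _ _) (hev _ _ _)
    · exact isClosed_iInter fun z => isClosed_eq (hev _ _ _) (hev _ _ _)
end

section
/- Assume moreover that the 𝕋-action is free (ω • z = z implies ω = 1). Then the algebra S is commutative if and only if Z_reg = ∅, i.e. if and only if Z = 𝕋 • Z_ℝ. -/
open MeasureTheory in
theorem exists_equivariant {Z : Type*} [TopologicalSpace Z] [CompactSpace Z] [T2Space Z]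
    [MulAction Circle Z] [ContinuousSMul Circle Z]
    (hfree : ∀ (ω : Circle) (z : Z), ω • z = z → ω = 1) (z w : Z)
    (hzw : ∀ ω : Circle, w ≠ ω • z) :
    ∃ f : C(Z, ℂ), (∀ (ω : Circle) (x : Z), f (ω • x) = (ω : ℂ) * f x) ∧ f z = 1 ∧ f w = 0 := by
  let e : Circle ⊕ Circle → Z := Sum.elim (fun ω => ω • z) (fun ω => ω • w)
  have hec : Continuous e := by
    refine Continuous.sumElim ?_ ?_ <;> fun_prop
  have hinj : ∀ x : Z, ∀ a b : Circle, a • x = b • x → a = b := by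
    intro x a b h
    have : (b⁻¹ * a) • x = x := by rw [mul_smul, h, inv_smul_smul]
    exact (inv_mul_eq_one.1 (hfree _ _ this)).symm
  have hne : ∀ a b : Circle, a • z ≠ b • w := by
    intro a b h
    apply hzw (b⁻¹ * a)
    rw [mul_smul, h, inv_smul_smul]
  have hei : Function.Injective e := by
    rintro (a | a) (b | b) h
    · exact congrArg _ (hinj z a b h)
    · exact (hne a b h).elim
    · exact (hne b a h.symm).elim
    · exact congrArg _ (hinj w a b h)
  have hce : Topology.IsClosedEmbedding e := hec.isClosedEmbedding hei
  let h₀ : C(Circle ⊕ Circle, ℂ) :=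
    ⟨Sum.elim (fun ω => (ω : ℂ)) (fun _ => 0), by
      refine Continuous.sumElim ?_ ?_ <;> fun_prop⟩
  obtain ⟨h, hh⟩ := h₀.exists_extension' hce
  have hz : ∀ ω : Circle, h (ω • z) = ω := fun ω => congrFun hh (Sum.inl ω)
  have hw : ∀ ω : Circle, h (ω • w) = 0 := fun ω => congrFun hh (Sum.inr ω)
  borelize Circle
  let μ : Measure Circle := Measure.haarMeasure ⊤
  have hμ : μ Set.univ = 1 := Measure.haarMeasure_self (K₀ := (⊤ : TopologicalSpace.PositiveCompacts Circle))
  haveI : IsProbabilityMeasure μ := ⟨hμ⟩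
  have hcont : Continuous fun x : Z => ∫ ω : Circle, ((ω⁻¹ : Circle) : ℂ) * h (ω • x) ∂μ := by
    rw [← continuousOn_univ]
    refine continuousOn_integral_of_compact_support (k := Set.univ) isCompact_univ ?_ ?_
    · apply Continuous.continuousOn
      unfold Function.uncurry
      fun_prop
    · intro p x _ hx
      exact (hx (Set.mem_univ _)).elim
  refine ⟨⟨_, hcont⟩, ?_, ?_, ?_⟩
  · intro η x
    change ∫ ω : Circle, ((ω⁻¹ : Circle) : ℂ) * h (ω • η • x) ∂μ
      = (η : ℂ) * ∫ ω : Circle, ((ω⁻¹ : Circle) : ℂ) * h (ω • x) ∂μ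
    rw [← integral_mul_left_eq_self (μ := μ) (fun ω : Circle => ((ω⁻¹ : Circle) : ℂ) * h (ω • x)) η,
      ← integral_const_mul]
    congr 1
    ext ω
    rw [smul_smul, mul_comm ω η, ← mul_assoc, ← Circle.coe_mul]
    rw [mul_inv, mul_inv_cancel_left]
  · change ∫ ω : Circle, ((ω⁻¹ : Circle) : ℂ) * h (ω • z) ∂μ = 1
    simp [hz]
  · change ∫ ω : Circle, ((ω⁻¹ : Circle) : ℂ) * h (ω • w) ∂μ = 0
    simp [hw]

/-- Assuming the `𝕋`-action is free, the algebra `S` (the concrete model of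
`C(Z_{ℝ,*})`) is commutative if and only if `Z = 𝕋 • Z_ℝ`, i.e. `Z_reg = ∅`. -/
theorem stmt9 {Z : Type*} [TopologicalSpace Z] [CompactSpace Z] [T2Space Z]
    [MulAction Circle Z] [ContinuousSMul Circle Z]
    (hfree : ∀ (ω : Circle) (z : Z), ω • z = z → ω = 1)
    (τ : C(Z, Z)) (hττ : ∀ z, τ (τ z) = z)
    (hτsmul : ∀ (ω : Circle) (z : Z), τ (ω • z) = ω⁻¹ • τ z)
    (S : Set C(Z, Matrix (Fin 2) (Fin 2) ℂ))
    (hS : ∀ F, F ∈ S ↔ ∃ f₀ f₁ : C(Z, ℂ),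
        (∀ (ω : Circle) (z : Z), f₀ (ω • z) = f₀ z) ∧
        (∀ (ω : Circle) (z : Z), f₁ (ω • z) = (ω : ℂ) * f₁ z) ∧
        ∀ z, F z = !![f₀ z, f₁ z; f₁ (τ z), f₀ (τ z)]) :
    (∀ F ∈ S, ∀ G ∈ S, F * G = G * F) ↔
      ∀ z : Z, ∃ (ω : Circle) (y : Z), τ y = y ∧ z = ω • y := by
  constructor
  · intro hcomm z
    by_cases hz : ∃ ω : Circle, τ z = ω • z
    · obtain ⟨ω, hω⟩ := hz
      obtain ⟨t, rfl⟩ : ∃ t : ℝ, Circle.exp t = ω := ⟨_, Circle.exp_arg ω⟩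
      have hsq : Circle.exp t = Circle.exp (t / 2) * Circle.exp (t / 2) := by
        rw [← Circle.exp_add, add_halves]
      refine ⟨(Circle.exp (t / 2))⁻¹, Circle.exp (t / 2) • z, ?_, ?_⟩
      · rw [hτsmul, hω, hsq, mul_smul, inv_smul_smul]
      · rw [inv_smul_smul]
    · push Not at hz
      have hz' : ∀ ω : Circle, z ≠ ω • τ z := by
        intro ω h
        apply hz ω⁻¹
        rw [eq_inv_smul_iff, ← h]
      obtain ⟨f, hf, hf1, hf0⟩ := exists_equivariant hfree z (τ z) hz
      obtain ⟨g, hg, hg1, hg0⟩ := exists_equivariant hfree (τ z) z hz'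
      have key : ∀ f : C(Z, ℂ), (∀ (ω : Circle) (x : Z), f (ω • x) = (ω : ℂ) * f x) →
          ∃ F ∈ S, ∀ z, F z = !![0, f z; f (τ z), 0] := by
        intro f hf
        have hc : Continuous fun z => (!![0, f z; f (τ z), 0] : Matrix (Fin 2) (Fin 2) ℂ) := by
          refine continuous_matrix fun i j => ?_
          fin_cases i <;> fin_cases j <;> simp <;> fun_prop
        refine ⟨⟨_, hc⟩, (hS _).2 ⟨0, f, by simp, hf, by simp⟩, fun _ => rfl⟩
      obtain ⟨F, hFS, hF⟩ := key f hf
      obtain ⟨G, hGS, hG⟩ := key g hg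
      have h := congrFun (congrFun (DFunLike.congr_fun (hcomm F hFS G hGS) z) 0) 0
      simp [hF, hG, Matrix.mul_apply, hf1, hf0, hg1, hg0] at h
  · intro hZ F hF G hG
    obtain ⟨f₀, f₁, hf₀, hf₁, hF⟩ := (hS F).1 hF
    obtain ⟨g₀, g₁, hg₀, hg₁, hG⟩ := (hS G).1 hG
    ext1 z
    obtain ⟨ω, y, hy, rfl⟩ := hZ z
    rw [ContinuousMap.mul_apply, ContinuousMap.mul_apply, hF, hG]
    simp only [hτsmul, hy, hf₀, hf₁, hg₀, hg₁]
    ext i j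
    fin_cases i <;> fin_cases j <;> simp [Matrix.mul_apply] <;> ring
end

section
/- Assume the 𝕋-action is free (ω • z = z implies ω = 1). For z ∈ Z, the evaluation image {F(z) : F ∈ S} equals all of M₂(ℂ) if and only if z ∈ Z_reg; moreover, when z ∈ 𝕋 • Z_ℝ the set {F(z) : F ∈ S} consists of pairwise commuting matrices. -/
open MeasureTheory in
lemma aux_interp {Z : Type*} [TopologicalSpace Z] [CompactSpace Z] [T2Space Z]
    [MulAction Circle Z] [ContinuousSMul Circle Z]
    (hfree : ∀ (ω : Circle) (z : Z), ω • z = z → ω = 1)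
    (z w : Z) (hzw : ∀ ω : Circle, ω • z ≠ w) (n : ℕ) (a b : ℂ) :
    ∃ f : C(Z, ℂ), (∀ (ω : Circle) (x : Z), f (ω • x) = (ω : ℂ) ^ n * f x) ∧
      f z = a ∧ f w = b := by
  have hinj : ∀ (x : Z) (p q : Circle), p • x = q • x → p = q := by
    intro x p q h
    have := hfree (q⁻¹ * p) x (by rw [mul_smul, h, inv_smul_smul])
    exact (inv_mul_eq_one.mp this).symm
  let e : Circle ⊕ Circle → Z := Sum.elim (fun ω => ω • z) (fun ω => ω • w)
  have hec : Continuous e := by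
    apply Continuous.sumElim <;> fun_prop
  have hei : Function.Injective e := by
    rintro (p | p) (q | q) h
    · exact congrArg _ (hinj _ _ _ h)
    · exfalso
      apply hzw (q⁻¹ * p)
      have h' : p • z = q • w := h
      rw [mul_smul, h', inv_smul_smul]
    · exfalso
      apply hzw (p⁻¹ * q)
      have h' : p • w = q • z := h
      rw [mul_smul, ← h', inv_smul_smul]
    · exact congrArg _ (hinj _ _ _ h)
  have he := hec.isClosedEmbedding hei
  let f : C(Circle ⊕ Circle, ℂ) :=
    ⟨Sum.elim (fun ω => (ω : ℂ) ^ n * a) (fun ω => (ω : ℂ) ^ n * b), by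
      apply Continuous.sumElim <;> fun_prop⟩
  obtain ⟨g, hg⟩ := f.exists_extension' he
  have hgz : ∀ ω : Circle, g (ω • z) = (ω : ℂ) ^ n * a := fun ω => congrFun hg (Sum.inl ω)
  have hgw : ∀ ω : Circle, g (ω • w) = (ω : ℂ) ^ n * b := fun ω => congrFun hg (Sum.inr ω)
  letI : MeasurableSpace Circle := borel Circle
  haveI : BorelSpace Circle := ⟨rfl⟩
  let μ : Measure Circle := Measure.haarMeasure ⊤
  haveI : IsProbabilityMeasure μ := ⟨by
    have := Measure.haarMeasure_self (K₀ := (⊤ : TopologicalSpace.PositiveCompacts Circle))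
    simpa using this⟩
  have hcont : Continuous (fun x : Z => ∫ ω : Circle, ((ω⁻¹ : Circle) : ℂ) ^ n * g (ω • x) ∂μ) := by
    rw [← continuousOn_univ]
    apply continuousOn_integral_of_compact_support (k := Set.univ) isCompact_univ
    · apply Continuous.continuousOn
      simp only [Function.uncurry_def]
      fun_prop
    · simp
  refine ⟨⟨_, hcont⟩, ?_, ?_, ?_⟩
  · intro η x
    simp only [ContinuousMap.coe_mk]
    rw [← integral_const_mul,
      ← integral_mul_right_eq_self (μ := μ)
        (fun ω : Circle => (η : ℂ) ^ n * (((ω⁻¹ : Circle) : ℂ) ^ n * g (ω • x))) η]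
    congr 1
    ext ω
    have hk : ω⁻¹ = η * (ω * η)⁻¹ := by rw [mul_inv_rev, mul_inv_cancel_left]
    rw [mul_smul, ← mul_assoc, ← mul_pow, ← Circle.coe_mul, ← hk]
  · simp only [ContinuousMap.coe_mk, hgz]
    simp [← mul_assoc, ← mul_pow]
  · simp only [ContinuousMap.coe_mk, hgw]
    simp [← mul_assoc, ← mul_pow]


/-- Assuming the `𝕋`-action is free: for `z ∈ Z` the evaluation image
`{F z : F ∈ S}` is all of `M₂(ℂ)` if and only if `z ∈ Z_reg`; moreover if
`z ∈ 𝕋 • Z_ℝ` then the matrices `F z`, `F ∈ S`, pairwise commute. -/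
theorem stmt10 {Z : Type*} [TopologicalSpace Z] [CompactSpace Z] [T2Space Z]
    [MulAction Circle Z] [ContinuousSMul Circle Z]
    (hfree : ∀ (ω : Circle) (z : Z), ω • z = z → ω = 1)
    (τ : C(Z, Z)) (hττ : ∀ z, τ (τ z) = z)
    (hτsmul : ∀ (ω : Circle) (z : Z), τ (ω • z) = ω⁻¹ • τ z)
    (S : Set C(Z, Matrix (Fin 2) (Fin 2) ℂ))
    (hS : ∀ F, F ∈ S ↔ ∃ f₀ f₁ : C(Z, ℂ),
        (∀ (ω : Circle) (z : Z), f₀ (ω • z) = f₀ z) ∧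
        (∀ (ω : Circle) (z : Z), f₁ (ω • z) = (ω : ℂ) * f₁ z) ∧
        ∀ z, F z = !![f₀ z, f₁ z; f₁ (τ z), f₀ (τ z)]) :
    ∀ z : Z,
      ({M : Matrix (Fin 2) (Fin 2) ℂ | ∃ F ∈ S, F z = M} = Set.univ ↔
        ¬ ∃ (ω : Circle) (y : Z), τ y = y ∧ z = ω • y) ∧
      ((∃ (ω : Circle) (y : Z), τ y = y ∧ z = ω • y) →
        ∀ F ∈ S, ∀ G ∈ S, F z * G z = G z * F z) := by
  have hcomm : ∀ z : Z, (∃ (ω : Circle) (y : Z), τ y = y ∧ z = ω • y) →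
        ∀ F ∈ S, ∀ G ∈ S, F z * G z = G z * F z := by
    rintro z ⟨ω, y, hy, rfl⟩ F hF G hG
    obtain ⟨f₀, f₁, h0, h1, hF⟩ := (hS F).1 hF
    obtain ⟨g₀, g₁, k0, k1, hG⟩ := (hS G).1 hG
    rw [hF, hG, hτsmul, hy]
    simp only [h0, h1, k0, k1, Matrix.mul_fin_two]
    ext i j
    fin_cases i <;> fin_cases j <;> simp <;> ring
  intro z
  refine ⟨⟨?_, ?_⟩, hcomm z⟩
  · intro hU hz
    have hA : !![0, 1; 0, 0] ∈ {M : Matrix (Fin 2) (Fin 2) ℂ | ∃ F ∈ S, F z = M} := by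
      rw [hU]; trivial
    have hB : !![0, 0; 1, 0] ∈ {M : Matrix (Fin 2) (Fin 2) ℂ | ∃ F ∈ S, F z = M} := by
      rw [hU]; trivial
    obtain ⟨F, hF, hFz⟩ := hA
    obtain ⟨G, hG, hGz⟩ := hB
    have h := hcomm z hz F hF G hG
    rw [hFz, hGz] at h
    have := congrFun (congrFun h 0) 0
    simp [Matrix.mul_fin_two] at this
  · intro hz
    have hzw : ∀ ω : Circle, ω • z ≠ τ z := by
      intro ω h
      obtain ⟨η, rfl⟩ : ∃ η : Circle, ω = η * η :=
        ⟨Circle.exp (Complex.arg ω / 2), by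
          rw [← Circle.exp_add, add_halves, Circle.exp_arg]⟩
      apply hz
      refine ⟨η⁻¹, η • z, ?_, ?_⟩
      · rw [hτsmul, ← h, mul_smul, inv_smul_smul]
      · rw [inv_smul_smul]
    rw [Set.eq_univ_iff_forall]
    intro M
    obtain ⟨f₀, h0, h0z, h0w⟩ := aux_interp hfree z (τ z) hzw 0 (M 0 0) (M 1 1)
    obtain ⟨f₁, h1, h1z, h1w⟩ := aux_interp hfree z (τ z) hzw 1 (M 0 1) (M 1 0)
    refine ⟨⟨fun z => !![f₀ z, f₁ z; f₁ (τ z), f₀ (τ z)], ?_⟩, ?_, ?_⟩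
    · apply continuous_matrix
      intro i j
      fin_cases i <;> fin_cases j <;> simp <;> fun_prop
    · rw [hS]
      exact ⟨f₀, f₁, by simpa using h0, by simpa using h1, fun _ => rfl⟩
    · simp only [ContinuousMap.coe_mk, h0z, h0w, h1z, h1w]
      exact (Matrix.eta_fin_two M).symm
end

section
/- For every y ∈ Z_ℝ, the map φ_y : S → ℂ defined by φ_y(F) = F(y)₁₁ + F(y)₁₂ (sum of the two entries of the first row of the matrix F(y)) is linear, unital, multiplicative (φ_y(F·G) = φ_y(F)·φ_y(G) for all F, G ∈ S) and star-preserving (φ_y(F*) = conj(φ_y(F)), where F* is the pointwise conjugate transpose). -/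
/-- For `y ∈ Z_ℝ`, the functional `φ_y(F) = F(y)₁₁ + F(y)₁₂` on `S` is linear, unital,
multiplicative and star-preserving. -/
theorem stmt11 {Z : Type*} [TopologicalSpace Z] [CompactSpace Z] [T2Space Z]
    [MulAction Circle Z] [ContinuousSMul Circle Z]
    (τ : C(Z, Z)) (hττ : ∀ z, τ (τ z) = z)
    (hτsmul : ∀ (ω : Circle) (z : Z), τ (ω • z) = ω⁻¹ • τ z)
    (S : Set C(Z, Matrix (Fin 2) (Fin 2) ℂ))
    (hS : ∀ F, F ∈ S ↔ ∃ f₀ f₁ : C(Z, ℂ),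
        (∀ (ω : Circle) (z : Z), f₀ (ω • z) = f₀ z) ∧
        (∀ (ω : Circle) (z : Z), f₁ (ω • z) = (ω : ℂ) * f₁ z) ∧
        ∀ z, F z = !![f₀ z, f₁ z; f₁ (τ z), f₀ (τ z)])
    (y : Z) (hy : τ y = y)
    (φ : C(Z, Matrix (Fin 2) (Fin 2) ℂ) → ℂ)
    (hφ : ∀ F, φ F = F y 0 0 + F y 0 1) :
    (∀ F ∈ S, ∀ G ∈ S, φ (F + G) = φ F + φ G) ∧
    (∀ (c : ℂ), ∀ F ∈ S, φ (c • F) = c * φ F) ∧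
    φ (1 : C(Z, Matrix (Fin 2) (Fin 2) ℂ)) = 1 ∧
    (∀ F ∈ S, ∀ G ∈ S, φ (F * G) = φ F * φ G) ∧
    (∀ F ∈ S, φ (star F) = (starRingEnd ℂ) (φ F)) := by
  have key : ∀ F ∈ S, F y 1 0 = F y 0 1 ∧ F y 1 1 = F y 0 0 := by
    intro F hF
    obtain ⟨f₀, f₁, -, -, h⟩ := (hS F).1 hF
    simp [h y, hy]
  refine ⟨?_, ?_, ?_, ?_, ?_⟩
  · intro F _ G _
    simp only [hφ, ContinuousMap.add_apply, Matrix.add_apply]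
    ring
  · intro c F _
    simp only [hφ, ContinuousMap.smul_apply, Matrix.smul_apply, smul_eq_mul]
    ring
  · simp [hφ]
  · intro F hF G hG
    obtain ⟨h1, h2⟩ := key G hG
    simp only [hφ, ContinuousMap.mul_apply, Matrix.mul_apply, Fin.sum_univ_two, h1, h2]
    ring
  · intro F hF
    obtain ⟨h1, h2⟩ := key F hF
    simp [hφ, ContinuousMap.star_apply, Matrix.star_apply, h1]
end

section
/- Assume the 𝕋-action is free (ω • z = z implies ω = 1). If y, z ∈ Z_ℝ satisfy F(y)₁₁ + F(y)₁₂ = F(z)₁₁ + F(z)₁₂ for every F ∈ S, then y = z. In other words, the characters φ_y, y ∈ Z_ℝ, are pairwise distinct. -/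
open MeasureTheory in
theorem stmt12_exists_equivariant {Z : Type*} [TopologicalSpace Z] [CompactSpace Z] [T2Space Z]
    [MulAction Circle Z] [ContinuousSMul Circle Z] (y : Z) (C : Set Z) (hC : IsClosed C)
    (hyC : y ∉ C) (hre : ∀ ω : Circle, (ω : ℂ).re ≤ 0 → ω • y ∈ C) :
    ∃ f : C(Z, ℂ), (∀ (ω : Circle) (z : Z), f (ω • z) = (ω : ℂ) * f z) ∧ f y ≠ 0 ∧
      ∀ x, (∀ ω : Circle, ω • x ∈ C) → f x = 0 := by
  borelize Circle
  let μ : Measure Circle := Measure.haarMeasure ⊤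
  obtain ⟨g, hg0, hg1, hg⟩ := exists_continuous_zero_one_of_isClosed hC
    (isClosed_singleton (x := y)) (Set.disjoint_singleton_right.2 hyC)
  let k : Z → Circle → ℂ := fun x ω => ((ω⁻¹ : Circle) : ℂ) * (g (ω • x) : ℂ)
  have hk : Continuous k.uncurry := by
    change Continuous fun p : Z × Circle => ((p.2⁻¹ : Circle) : ℂ) * (g (p.2 • p.1) : ℂ)
    fun_prop
  have hf : Continuous fun x => ∫ ω, k x ω ∂μ := by
    rw [← continuousOn_univ]
    exact continuousOn_integral_of_compact_support isCompact_univ hk.continuousOn (by simp)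
  have hky : Continuous (k y) := by
    change Continuous fun ω : Circle => ((ω⁻¹ : Circle) : ℂ) * (g (ω • y) : ℂ)
    fun_prop
  refine ⟨⟨_, hf⟩, ?_, ?_, ?_⟩
  · intro l x
    change ∫ ω, k (l • x) ω ∂μ = l * ∫ ω, k x ω ∂μ
    rw [← integral_const_mul, ← integral_mul_right_eq_self (fun ω : Circle => (l : ℂ) * k x ω) l]
    congr 1
    ext ω
    have hl : (l : ℂ) ≠ 0 := Circle.coe_ne_zero l
    have hω : (ω : ℂ) ≠ 0 := Circle.coe_ne_zero ω
    simp only [k, Circle.coe_inv, Circle.coe_mul, smul_smul]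
    field_simp
  · change ∫ ω, k y ω ∂μ ≠ 0
    have hint : Integrable (k y) μ :=
      hky.integrable_of_hasCompactSupport (HasCompactSupport.of_compactSpace _)
    have hval : ∀ ω, (k y ω).re = (ω : ℂ).re * g (ω • y) := by
      intro ω
      simp [k, Circle.coe_inv_eq_conj]
    have hpos : 0 < ∫ ω, (k y ω).re ∂μ := by
      refine integral_pos_of_integrable_nonneg_nonzero (x := (1 : Circle))
        (Complex.continuous_re.comp hky) hint.re ?_ ?_
      · intro ω
        change 0 ≤ (k y ω).re
        rw [hval]
        rcases le_or_gt (ω : ℂ).re 0 with h | h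
        · have := hg0 (hre ω h)
          simp [this]
        · exact mul_nonneg h.le (hg _).1
      · rw [hval]
        have : g y = 1 := hg1 rfl
        simp [this]
    intro h0
    have h1 : ∫ ω, (k y ω).re ∂μ = (∫ ω, k y ω ∂μ).re := integral_re hint
    rw [h1, h0] at hpos
    simp at hpos
  · intro x hx
    change ∫ ω, k x ω ∂μ = 0
    have : ∀ ω, k x ω = 0 := by
      intro ω
      have := hg0 (hx ω)
      simp [k, this]
    simp [this]

/-- Assuming the `𝕋`-action is free, the characters `φ_y`, `y ∈ Z_ℝ`, of `S` are
pairwise distinct: if `F(y)₁₁ + F(y)₁₂ = F(z)₁₁ + F(z)₁₂` for all `F ∈ S` with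
`y, z ∈ Z_ℝ`, then `y = z`. -/
theorem stmt12 {Z : Type*} [TopologicalSpace Z] [CompactSpace Z] [T2Space Z]
    [MulAction Circle Z] [ContinuousSMul Circle Z]
    (hfree : ∀ (ω : Circle) (z : Z), ω • z = z → ω = 1)
    (τ : C(Z, Z)) (hττ : ∀ z, τ (τ z) = z)
    (hτsmul : ∀ (ω : Circle) (z : Z), τ (ω • z) = ω⁻¹ • τ z)
    (S : Set C(Z, Matrix (Fin 2) (Fin 2) ℂ))
    (hS : ∀ F, F ∈ S ↔ ∃ f₀ f₁ : C(Z, ℂ),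
        (∀ (ω : Circle) (z : Z), f₀ (ω • z) = f₀ z) ∧
        (∀ (ω : Circle) (z : Z), f₁ (ω • z) = (ω : ℂ) * f₁ z) ∧
        ∀ z, F z = !![f₀ z, f₁ z; f₁ (τ z), f₀ (τ z)])
    (y z : Z) (hy : τ y = y) (hz : τ z = z)
    (h : ∀ F ∈ S, F y 0 0 + F y 0 1 = F z 0 0 + F z 0 1) :
    y = z := by
  have hcl : IsClosed ((fun ω : Circle => ω • y) '' {ω : Circle | (ω : ℂ).re ≤ 0}) := by
    refine (IsCompact.image (IsClosed.isCompact ?_) (by fun_prop)).isClosed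
    exact isClosed_le (by fun_prop) continuous_const
  have hyn : y ∉ ((fun ω : Circle => ω • y) '' {ω : Circle | (ω : ℂ).re ≤ 0}) := by
    rintro ⟨ω, hω, he⟩
    have h1 := hfree ω y he
    subst h1
    simp only [Set.mem_setOf_eq, Circle.coe_one, Complex.one_re] at hω
    linarith
  have heq : ∀ f : C(Z, ℂ), (∀ (ω : Circle) (z : Z), f (ω • z) = (ω : ℂ) * f z) → f y = f z := by
    intro f hf
    have := h ⟨fun x => !![0, f x; f (τ x), 0], by
      refine continuous_matrix fun i j => ?_
      fin_cases i <;> fin_cases j <;> simp <;> fun_prop⟩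
      ((hS _).2 ⟨0, f, by simp, hf, by intro x; simp⟩)
    simpa using this
  by_cases ho : ∃ l : Circle, l • y = z
  · obtain ⟨l, rfl⟩ := ho
    obtain ⟨f, hf, hfy, -⟩ := stmt12_exists_equivariant y _ hcl hyn
      (fun ω hω => ⟨ω, hω, rfl⟩)
    have h1 := heq f hf
    rw [hf] at h1
    have h2 : (l : ℂ) = 1 := by
      apply mul_right_cancel₀ hfy
      rw [one_mul, ← h1]
    have h3 : l = 1 := Circle.ext (by simpa using h2)
    simp [h3]
  · exfalso
    obtain ⟨f, hf, hfy, hfz⟩ := stmt12_exists_equivariant y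
      (((fun ω : Circle => ω • y) '' {ω : Circle | (ω : ℂ).re ≤ 0}) ∪
        Set.range (fun ω : Circle => ω • z))
      (hcl.union (isCompact_range (by fun_prop)).isClosed)
      (by
        rintro (h1 | ⟨ω, hω⟩)
        · exact hyn h1
        · apply ho
          refine ⟨ω⁻¹, ?_⟩
          rw [← hω]
          simp)
      (fun ω hω => Or.inl ⟨ω, hω, rfl⟩)
    apply hfy
    rw [heq f hf]
    exact hfz z fun ω => Or.inr ⟨ω, rfl⟩
end

section
/- For z, x ∈ Z, there exists a unitary u ∈ M₂(ℂ) with F(x) = u · F(z) · u* for all F ∈ S if and only if x lies in the 𝕋 ⋊ ℤ₂-orbit of z, i.e. if and only if there exists ω ∈ 𝕋 with x = ω • z or x = ω • τ(z). -/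
/-- For `z, x ∈ Z`, the evaluation representations of `S` at `x` and `z` are unitarily
equivalent (via a single unitary `u ∈ M₂(ℂ)`) if and only if `x` lies in the
`𝕋 ⋊ ℤ₂`-orbit of `z`. -/
theorem stmt13 {Z : Type*} [TopologicalSpace Z] [CompactSpace Z] [T2Space Z]
    [MulAction Circle Z] [ContinuousSMul Circle Z]
    (τ : C(Z, Z)) (hττ : ∀ z, τ (τ z) = z)
    (hτsmul : ∀ (ω : Circle) (z : Z), τ (ω • z) = ω⁻¹ • τ z)
    (S : Set C(Z, Matrix (Fin 2) (Fin 2) ℂ))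
    (hS : ∀ F, F ∈ S ↔ ∃ f₀ f₁ : C(Z, ℂ),
        (∀ (ω : Circle) (z : Z), f₀ (ω • z) = f₀ z) ∧
        (∀ (ω : Circle) (z : Z), f₁ (ω • z) = (ω : ℂ) * f₁ z) ∧
        ∀ z, F z = !![f₀ z, f₁ z; f₁ (τ z), f₀ (τ z)])
    (z x : Z) :
    (∃ u : Matrix (Fin 2) (Fin 2) ℂ, u ∈ unitary (Matrix (Fin 2) (Fin 2) ℂ) ∧
        ∀ F ∈ S, F x = u * F z * star u) ↔
      ∃ ω : Circle, x = ω • z ∨ x = ω • τ z := by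
  constructor
  · rintro ⟨u, hu, h⟩
    by_contra hne
    push Not at hne
    have : ProperSMul Circle Z :=
      ⟨Continuous.isProperMap (by fun_prop)⟩
    let Q := Quotient (MulAction.orbitRel Circle Z)
    let q : Z → Q := Quotient.mk _
    have hq : Continuous q := continuous_quotient_mk'
    have : T2Space Q := t2Space_quotient_mulAction_of_properSMul
    have hqi : ∀ (ω : Circle) (y : Z), q (ω • y) = q y := fun ω y =>
      Quotient.sound (MulAction.orbitRel_apply.2 ⟨ω, rfl⟩)
    have hqe : ∀ a b : Z, q a = q b → ∃ ω : Circle, a = ω • b := by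
      intro a b hab
      obtain ⟨ω, hω⟩ := MulAction.orbitRel_apply.1 (Quotient.exact hab)
      exact ⟨ω, hω.symm⟩
    obtain ⟨g, g0, g1, gI⟩ := exists_continuous_zero_one_of_isClosed
      (s := ({q z, q (τ z)} : Set Q)) (t := {q x})
      (Set.toFinite _).isClosed isClosed_singleton (by
        rw [Set.disjoint_singleton_right]
        rintro (h1 | h1)
        · obtain ⟨ω, hω⟩ := hqe _ _ h1
          exact (hne ω).1 hω
        · obtain ⟨ω, hω⟩ := hqe _ _ h1
          exact (hne ω).2 hω)
    let f : C(Z, ℂ) := ⟨fun y => ((g (q y) : ℝ) : ℂ), by fun_prop⟩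
    let F : C(Z, Matrix (Fin 2) (Fin 2) ℂ) := ⟨fun y => !![f y, 0; 0, f (τ y)], by
      refine continuous_matrix fun i j => ?_
      fin_cases i <;> fin_cases j <;> simp <;> fun_prop⟩
    have hF := h F ((hS F).2 ⟨f, 0, fun ω y => by simp [f, hqi], by simp, fun y => by simp [F]⟩)
    have hz : F z = 0 := by
      have h1 : g (q z) = 0 := g0 (by simp)
      have h2 : g (q (τ z)) = 0 := g0 (by simp)
      ext i j
      fin_cases i <;> fin_cases j <;> simp [F, f, h1, h2]
    have h3 : g (q x) = 1 := g1 (by simp)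
    rw [hz] at hF
    have := congrFun (congrFun hF 0) 0
    simp [F, f, h3] at this
  · have key : ∀ (ω : Circle), (!![(ω : ℂ), 0; 0, 1] : Matrix (Fin 2) (Fin 2) ℂ) ∈
        unitary (Matrix (Fin 2) (Fin 2) ℂ) := by
      intro ω
      have h1 : (ω : ℂ) * (starRingEnd ℂ) ω = 1 := by
        rw [← Circle.coe_inv_eq_conj, ← Circle.coe_mul]; simp
      have h2 : (starRingEnd ℂ) ω * (ω : ℂ) = 1 := by rw [mul_comm, h1]
      rw [Unitary.mem_iff]
      constructor <;> ext i j <;> fin_cases i <;> fin_cases j <;>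
        simp [Matrix.mul_apply, Fin.sum_univ_two, Matrix.star_apply, h1, h2]
    have sw : (!![0, 1; 1, 0] : Matrix (Fin 2) (Fin 2) ℂ) ∈
        unitary (Matrix (Fin 2) (Fin 2) ℂ) := by
      rw [Unitary.mem_iff]
      constructor <;> ext i j <;> fin_cases i <;> fin_cases j <;>
        simp [Matrix.mul_apply, Fin.sum_univ_two, Matrix.star_apply]
    have A : ∀ (ω : Circle) (y : Z), ∀ F ∈ S, F (ω • y) = !![(ω : ℂ), 0; 0, 1] * F y *
        star !![(ω : ℂ), 0; 0, 1] := by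
      intro ω y F hF
      obtain ⟨f₀, f₁, h0, h1, hf⟩ := (hS F).1 hF
      have e : (ω : ℂ) * f₀ y * (starRingEnd ℂ) ω = f₀ y := by
        have h1 : (ω : ℂ) * (starRingEnd ℂ) ω = 1 := by
          rw [← Circle.coe_inv_eq_conj, ← Circle.coe_mul]; simp
        linear_combination f₀ y * h1
      rw [hf, hf, hτsmul, h0, h0, h1, h1, Circle.coe_inv_eq_conj]
      ext i j
      fin_cases i <;> fin_cases j <;>
        simp [Matrix.mul_apply, Fin.sum_univ_two, Matrix.star_apply, e]
      exact mul_comm _ _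
    have B : ∀ (y : Z), ∀ F ∈ S, F (τ y) = !![0, 1; 1, 0] * F y * star !![0, 1; 1, 0] := by
      intro y F hF
      obtain ⟨f₀, f₁, h0, h1, hf⟩ := (hS F).1 hF
      rw [hf, hf, hττ]
      ext i j
      fin_cases i <;> fin_cases j <;>
        simp [Matrix.mul_apply, Fin.sum_univ_two, Matrix.star_apply]
    rintro ⟨ω, rfl | rfl⟩
    · exact ⟨_, key ω, A ω z⟩
    · refine ⟨_, mul_mem (key ω) sw, fun F hF => ?_⟩
      rw [A ω _ F hF, B z F hF, star_mul]
      simp only [mul_assoc]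
end

section
/- Let E ⊆ Z_reg be stable under the 𝕋-action and under τ, and let y ∈ Z_ℝ. Then the following are equivalent: (i) every F ∈ S that vanishes identically on E (F(z) = 0 for all z ∈ E) satisfies F(y)₁₁ + F(y)₁₂ = 0; (ii) y belongs to the topological closure of E in Z. -/
/-- Let `E ⊆ Z_reg` be `𝕋`-stable and `τ`-stable and let `y ∈ Z_ℝ`.  Then every
`F ∈ S` vanishing identically on `E` satisfies `F(y)₁₁ + F(y)₁₂ = 0` if and only if
`y` belongs to the closure of `E`. -/
theorem stmt14 {Z : Type*} [TopologicalSpace Z] [CompactSpace Z] [T2Space Z]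
    [MulAction Circle Z] [ContinuousSMul Circle Z]
    (τ : C(Z, Z)) (hττ : ∀ z, τ (τ z) = z)
    (hτsmul : ∀ (ω : Circle) (z : Z), τ (ω • z) = ω⁻¹ • τ z)
    (S : Set C(Z, Matrix (Fin 2) (Fin 2) ℂ))
    (hS : ∀ F, F ∈ S ↔ ∃ f₀ f₁ : C(Z, ℂ),
        (∀ (ω : Circle) (z : Z), f₀ (ω • z) = f₀ z) ∧
        (∀ (ω : Circle) (z : Z), f₁ (ω • z) = (ω : ℂ) * f₁ z) ∧
        ∀ z, F z = !![f₀ z, f₁ z; f₁ (τ z), f₀ (τ z)])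
    (E : Set Z)
    (hEreg : ∀ z ∈ E, ¬ ∃ (ω : Circle) (y : Z), τ y = y ∧ z = ω • y)
    (hET : ∀ (ω : Circle), ∀ z ∈ E, ω • z ∈ E)
    (hEτ : ∀ z ∈ E, τ z ∈ E)
    (y : Z) (hy : τ y = y) :
    (∀ F ∈ S, (∀ z ∈ E, F z = 0) → F y 0 0 + F y 0 1 = 0) ↔ y ∈ closure E := by
  constructor
  · intro h
    by_contra hyE
    obtain ⟨u, hu0, hu1, hu⟩ := exists_continuous_zero_one_of_isClosed
      (isClosed_closure (s := E)) (isClosed_singleton (x := y))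
      (Set.disjoint_singleton_right.mpr hyE)
    have hcont : Continuous (fun z : Z =>
        sSup ((fun ω : Circle => u (ω • z)) '' Set.univ)) := by
      refine IsCompact.continuous_sSup (f := fun (z : Z) (ω : Circle) => u (ω • z))
        isCompact_univ ?_
      exact u.continuous.comp (continuous_snd.smul continuous_fst)
    let g : Z → ℝ := fun z => sSup ((fun ω : Circle => u (ω • z)) '' Set.univ)
    have hg : Continuous g := hcont
    have hginv : ∀ (ω : Circle) (z : Z), g (ω • z) = g z := by
      intro ω z
      have : (fun η : Circle => u (η • ω • z)) '' Set.univ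
          = (fun η : Circle => u (η • z)) '' Set.univ := by
        ext x
        constructor
        · rintro ⟨η, -, rfl⟩
          exact ⟨η * ω, trivial, by simp [mul_smul]⟩
        · rintro ⟨η, -, rfl⟩
          exact ⟨η * ω⁻¹, trivial, by simp [mul_smul]⟩
      exact congrArg sSup this
    have hgE : ∀ z ∈ E, g z = 0 := by
      intro z hz
      have : (fun η : Circle => u (η • z)) '' Set.univ = {0} := by
        ext x
        constructor
        · rintro ⟨η, -, rfl⟩
          exact hu0 (subset_closure (hET η z hz))
        · rintro rfl
          exact ⟨1, trivial, hu0 (subset_closure (hET 1 z hz))⟩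
      change sSup _ = _
      rw [this, csSup_singleton]
    have hgy : 1 ≤ g y := by
      refine le_csSup ⟨1, ?_⟩ ⟨1, trivial, ?_⟩
      · rintro _ ⟨η, -, rfl⟩
        exact (hu _).2
      · simpa using hu1 rfl
    let f₀ : C(Z, ℂ) := ⟨fun z => (g z : ℂ), Complex.continuous_ofReal.comp hg⟩
    let F : C(Z, Matrix (Fin 2) (Fin 2) ℂ) :=
      ⟨fun z => !![f₀ z, 0; 0, f₀ (τ z)], by
        refine continuous_matrix ?_
        intro i j
        fin_cases i <;> fin_cases j <;> simp <;> fun_prop⟩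
    have hF := h F ((hS F).2 ⟨f₀, 0, fun ω z => by simp [f₀, hginv], by simp,
      fun z => by simp [F]⟩) (fun z hz => by
        ext i j
        fin_cases i <;> fin_cases j <;> simp [F, f₀, hgE z hz, hgE _ (hEτ z hz)])
    have : g y = 0 := by simpa [F, f₀] using hF
    linarith
  · intro hyE F _ hF
    have hcl : IsClosed {z | F z = 0} := isClosed_eq F.continuous continuous_const
    have : F y = 0 := closure_minimal (fun z hz => hF z hz) hcl hyE
    simp [this]
end

section
/- Let E ⊆ Z_reg be stable under the 𝕋-action and under τ, and let y ∈ Z_reg. Then the following are equivalent: (i) every F ∈ S that vanishes identically on E (F(z) = 0 for all z ∈ E) satisfies F(y) = 0; (ii) y belongs to the topological closure of E in Z. -/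
/-- Let `E ⊆ Z_reg` be `𝕋`-stable and `τ`-stable and let `y ∈ Z_reg`.  Then every
`F ∈ S` vanishing identically on `E` satisfies `F y = 0` if and only if `y` belongs
to the closure of `E`. -/
theorem stmt15 {Z : Type*} [TopologicalSpace Z] [CompactSpace Z] [T2Space Z]
    [MulAction Circle Z] [ContinuousSMul Circle Z]
    (τ : C(Z, Z)) (hττ : ∀ z, τ (τ z) = z)
    (hτsmul : ∀ (ω : Circle) (z : Z), τ (ω • z) = ω⁻¹ • τ z)
    (S : Set C(Z, Matrix (Fin 2) (Fin 2) ℂ))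
    (hS : ∀ F, F ∈ S ↔ ∃ f₀ f₁ : C(Z, ℂ),
        (∀ (ω : Circle) (z : Z), f₀ (ω • z) = f₀ z) ∧
        (∀ (ω : Circle) (z : Z), f₁ (ω • z) = (ω : ℂ) * f₁ z) ∧
        ∀ z, F z = !![f₀ z, f₁ z; f₁ (τ z), f₀ (τ z)])
    (E : Set Z)
    (hEreg : ∀ z ∈ E, ¬ ∃ (ω : Circle) (y : Z), τ y = y ∧ z = ω • y)
    (hET : ∀ (ω : Circle), ∀ z ∈ E, ω • z ∈ E)
    (hEτ : ∀ z ∈ E, τ z ∈ E)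
    (y : Z) (hy : ¬ ∃ (ω : Circle) (w : Z), τ w = w ∧ y = ω • w) :
    (∀ F ∈ S, (∀ z ∈ E, F z = 0) → F y = 0) ↔ y ∈ closure E := by
  constructor
  · intro H
    by_contra hyE
    obtain ⟨h, h0, h1, h01⟩ := exists_continuous_zero_one_of_isClosed
      (isClosed_closure (s := E)) (isClosed_singleton (x := y))
      (Set.disjoint_singleton_right.mpr hyE)
    let g : Z → ℝ := fun z => sSup ((fun ω : Circle => h (ω • z)) '' Set.univ)
    have hg : Continuous g := by
      refine IsCompact.continuous_sSup (f := fun (z : Z) (ω : Circle) => h (ω • z))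
        isCompact_univ ?_
      exact h.continuous.comp (continuous_snd.smul continuous_fst)
    have hginv : ∀ (ω : Circle) (z : Z), g (ω • z) = g z := by
      intro ω z
      show sSup _ = sSup _
      congr 1
      ext t
      constructor
      · rintro ⟨a, -, rfl⟩
        exact ⟨a * ω, trivial, by simp [mul_smul]⟩
      · rintro ⟨a, -, rfl⟩
        exact ⟨a * ω⁻¹, trivial, by simp [mul_smul]⟩
    have hgE : ∀ z ∈ E, g z = 0 := by
      intro z hz
      have : (fun ω : Circle => h (ω • z)) '' Set.univ = {0} := by
        ext t
        constructor
        · rintro ⟨a, -, rfl⟩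
          exact h0 (subset_closure (hET a z hz))
        · rintro rfl
          exact ⟨1, trivial, h0 (subset_closure (hET 1 z hz))⟩
      show sSup _ = 0
      rw [this, csSup_singleton]
    have hgy : 1 ≤ g y := by
      refine le_csSup ⟨1, ?_⟩ ⟨1, trivial, ?_⟩
      · rintro _ ⟨a, -, rfl⟩
        exact (h01 _).2
      · simpa using h1 (Set.mem_singleton y)
    let f₀ : C(Z, ℂ) := ⟨fun z => (g z : ℂ), Complex.continuous_ofReal.comp hg⟩
    let F : C(Z, Matrix (Fin 2) (Fin 2) ℂ) :=
      ⟨fun z => !![f₀ z, 0; 0, f₀ (τ z)], by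
        refine continuous_matrix fun i j => ?_
        fin_cases i <;> fin_cases j <;> simp <;> fun_prop⟩
    have hF : F ∈ S := by
      rw [hS]
      refine ⟨f₀, 0, fun ω z => ?_, fun ω z => by simp, fun z => by simp [F]⟩
      simp [f₀, hginv]
    have hFy := H F hF (by
      intro z hz
      ext i j
      fin_cases i <;> fin_cases j <;> simp [F, f₀, hgE z hz, hgE _ (hEτ z hz)])
    have h00 := congrFun (congrFun hFy 0) 0
    simp [F, f₀] at h00
    linarith
  · intro hyE F _ hFE
    have hcl : IsClosed {z | F z = 0} := isClosed_eq F.continuous continuous_const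
    exact closure_minimal (fun z hz => hFE z hz) hcl hyE
end

section
/- Let n ≥ 1 and let Z = {z ∈ ℂⁿ : ‖z‖ = 1} be the unit sphere. For 1 ≤ i ≤ n define V_i ∈ C(Z, M₂(ℂ)) by V_i(z) = !![0, z_i; conj(z_i), 0]. Then: (a) each V_i is self-adjoint (equal to its pointwise conjugate transpose); (b) ∑_{i=1}^n V_i² = 1 (the constant identity matrix function); (c) V_i V_j V_k = V_k V_j V_i for all i, j, k; and (d) if n ≥ 2 then V₁ V₂ ≠ V₂ V₁, so the algebra generated by the V_i is noncommutative. -/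
/-- The concrete matrix model of the generators of the half-liberated sphere: the
functions `V i : z ↦ !![0, z i; conj (z i), 0]` on the unit sphere of `ℂⁿ` are
self-adjoint, satisfy `∑ i, (V i)² = 1` and the half-commutation relations
`V i * V j * V k = V k * V j * V i`, and for `n ≥ 2` they do not commute. -/
theorem stmt17 (n : ℕ) (hn : 1 ≤ n)
    (V : Fin n → C(Metric.sphere (0 : EuclideanSpace ℂ (Fin n)) 1,
      Matrix (Fin 2) (Fin 2) ℂ))
    (hV : ∀ (i : Fin n) (z : Metric.sphere (0 : EuclideanSpace ℂ (Fin n)) 1),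
      V i z = !![0, (z : EuclideanSpace ℂ (Fin n)) i;
        (starRingEnd ℂ) ((z : EuclideanSpace ℂ (Fin n)) i), 0]) :
    (∀ i, star (V i) = V i) ∧
    (∑ i, V i * V i) = 1 ∧
    (∀ i j k, V i * V j * V k = V k * V j * V i) ∧
    (∀ h2 : 2 ≤ n,
      V ⟨0, by omega⟩ * V ⟨1, by omega⟩ ≠ V ⟨1, by omega⟩ * V ⟨0, by omega⟩) := by
  refine ⟨?_, ?_, ?_, ?_⟩
  · intro i
    ext z a b
    rw [ContinuousMap.star_apply, hV]
    fin_cases a <;> fin_cases b <;> simp [Matrix.star_apply]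
  · ext z a b
    have hz : ∑ i, (z : EuclideanSpace ℂ (Fin n)) i *
        (starRingEnd ℂ) ((z : EuclideanSpace ℂ (Fin n)) i) = 1 := by
      have h1 : ‖(z : EuclideanSpace ℂ (Fin n))‖ = 1 := by simp
      have h2 := EuclideanSpace.norm_sq_eq (z : EuclideanSpace ℂ (Fin n))
      rw [h1] at h2
      simp only [Complex.mul_conj, Complex.normSq_eq_norm_sq]
      rw [← Complex.ofReal_sum, ← h2]
      norm_num
    rw [ContinuousMap.sum_apply, Matrix.sum_apply]
    simp only [ContinuousMap.mul_apply, hV, ContinuousMap.one_apply]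
    fin_cases a <;> fin_cases b <;> simp [Matrix.mul_apply, Fin.sum_univ_two, hz]
    simpa [mul_comm] using hz
  · intro i j k
    ext z a b
    simp only [ContinuousMap.mul_apply, hV]
    fin_cases a <;> fin_cases b <;> simp [Matrix.mul_apply, Fin.sum_univ_two] <;> ring
  · intro h2 h
    obtain ⟨m, rfl⟩ : ∃ m, n = m + 2 := ⟨n - 2, by omega⟩
    let w : EuclideanSpace ℂ (Fin (m + 2)) :=
      WithLp.toLp 2 (Fin.cons (3 / 5) (Fin.cons (4 / 5 * Complex.I) (fun _ => 0)))
    have w0 : w ⟨0, by omega⟩ = 3 / 5 := rfl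
    have w1 : w ⟨1, by omega⟩ = 4 / 5 * Complex.I := rfl
    have hw : w ∈ Metric.sphere (0 : EuclideanSpace ℂ (Fin (m + 2))) 1 := by
      rw [mem_sphere_zero_iff_norm, EuclideanSpace.norm_eq, Real.sqrt_eq_one]
      simp [w, Fin.sum_univ_succ]
      norm_num
    have h3 := congrArg (fun f => f ⟨w, hw⟩ 0 0) h
    simp only [ContinuousMap.mul_apply, hV, w0, w1] at h3
    have h4 := congrArg Complex.im h3
    simp [Matrix.mul_apply, Fin.sum_univ_two] at h4
    norm_num [Complex.conj_ofNat] at h4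
end

section
/- Let z = λ • y with λ ∈ 𝕋 and y ∈ Z_ℝ. Then there exists a unitary u ∈ M₂(ℂ), independent of F, such that for every F ∈ S: u · F(z) · u* = !![F(y)₁₁ + F(y)₁₂, 0; 0, F(y)₁₁ − F(y)₁₂]. In particular the two-dimensional representation of S given by evaluation at z decomposes as the direct sum of the characters φ_y and φ_{(-1) • y}. -/
/-- If `z = λ • y` with `λ ∈ 𝕋` and `y ∈ Z_ℝ`, then there is a unitary `u ∈ M₂(ℂ)`,
independent of `F`, such that `u · F(z) · u*` is the diagonal matrix with entries
`F(y)₁₁ + F(y)₁₂` and `F(y)₁₁ − F(y)₁₂` for every `F ∈ S`: the evaluation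
representation at `z` decomposes as `φ_y ⊕ φ_{-y}`. -/
theorem stmt18 {Z : Type*} [TopologicalSpace Z] [CompactSpace Z] [T2Space Z]
    [MulAction Circle Z] [ContinuousSMul Circle Z]
    (τ : C(Z, Z)) (hττ : ∀ z, τ (τ z) = z)
    (hτsmul : ∀ (ω : Circle) (z : Z), τ (ω • z) = ω⁻¹ • τ z)
    (S : Set C(Z, Matrix (Fin 2) (Fin 2) ℂ))
    (hS : ∀ F, F ∈ S ↔ ∃ f₀ f₁ : C(Z, ℂ),
        (∀ (ω : Circle) (z : Z), f₀ (ω • z) = f₀ z) ∧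
        (∀ (ω : Circle) (z : Z), f₁ (ω • z) = (ω : ℂ) * f₁ z) ∧
        ∀ z, F z = !![f₀ z, f₁ z; f₁ (τ z), f₀ (τ z)])
    (l : Circle) (y : Z) (hy : τ y = y) (z : Z) (hz : z = l • y) :
    ∃ u : Matrix (Fin 2) (Fin 2) ℂ, u ∈ unitary (Matrix (Fin 2) (Fin 2) ℂ) ∧
      ∀ F ∈ S, u * F z * star u =
        !![F y 0 0 + F y 0 1, 0; 0, F y 0 0 - F y 0 1] := by
  obtain ⟨s, hs, hss⟩ : ∃ s : ℂ, (starRingEnd ℂ) s = s ∧ s * s = 1 / 2 := by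
    refine ⟨((Real.sqrt (1 / 2) : ℝ) : ℂ), Complex.conj_ofReal _, ?_⟩
    rw [← Complex.ofReal_mul, Real.mul_self_sqrt (by norm_num)]
    norm_num
  obtain ⟨L, hL⟩ : ∃ L : ℂ, L = (l : ℂ) := ⟨_, rfl⟩
  obtain ⟨M, hM⟩ : ∃ M : ℂ, M = (starRingEnd ℂ) L := ⟨_, rfl⟩
  have hM' : (starRingEnd ℂ) M = L := by rw [hM]; simp
  have hLM : L * M = 1 := by
    rw [hM, Complex.mul_conj, hL]; simp
  have hinv : ((l⁻¹ : Circle) : ℂ) = M := by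
    rw [Circle.coe_inv_eq_conj, hM, hL]
  have hstar : star (!![s * M, s; s * M, -s] : Matrix (Fin 2) (Fin 2) ℂ)
      = !![s * L, s * L; s, -s] := by
    ext i j
    fin_cases i <;> fin_cases j <;> simp [Matrix.star_apply, hs, hM']
  refine ⟨!![s * M, s; s * M, -s], ?_, ?_⟩
  · rw [Unitary.mem_iff, hstar]
    constructor <;> ext i j <;> fin_cases i <;> fin_cases j <;>
      simp [Matrix.mul_apply, Fin.sum_univ_two] <;> grind
  · intro F hF
    obtain ⟨f₀, f₁, h0, h1, h⟩ := (hS F).1 hF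
    have e : F z = !![f₀ y, L * f₁ y; M * f₁ y, f₀ y] := by
      rw [h, hz, hτsmul, hy, h0, h0, h1, h1, hinv, hL]
    rw [e, h y, hstar]
    ext i j
    fin_cases i <;> fin_cases j <;>
      simp [Matrix.mul_apply, Fin.sum_univ_two] <;> grind
end

section
/- For every z ∈ Z_reg there exists a continuous 𝕋-invariant function f₀ : Z → ℂ (f₀(ω • y) = f₀(y) for all ω ∈ 𝕋, y ∈ Z) such that f₀(z) ≠ f₀(τ(z)). -/
/-- For every `z ∈ Z_reg` there is a continuous `𝕋`-invariant function `f₀ : Z → ℂ`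
with `f₀ z ≠ f₀ (τ z)`. -/
theorem stmt19 {Z : Type*} [TopologicalSpace Z] [CompactSpace Z] [T2Space Z]
    [MulAction Circle Z] [ContinuousSMul Circle Z]
    (τ : C(Z, Z)) (hττ : ∀ z, τ (τ z) = z)
    (hτsmul : ∀ (ω : Circle) (z : Z), τ (ω • z) = ω⁻¹ • τ z)
    (z : Z) (hz : ¬ ∃ (ω : Circle) (y : Z), τ y = y ∧ z = ω • y) :
    ∃ f₀ : C(Z, ℂ), (∀ (ω : Circle) (y : Z), f₀ (ω • y) = f₀ y) ∧
      f₀ z ≠ f₀ (τ z) := by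
  have hp : ProperSMul Circle Z := by
    constructor
    apply Continuous.isProperMap
    fun_prop
  let q : Z → Quotient (MulAction.orbitRel Circle Z) := fun y => Quotient.mk _ y
  have hq : Continuous q := continuous_quotient_mk'
  have hinv : ∀ (ω : Circle) (y : Z), q (ω • y) = q y := fun ω y =>
    Quotient.sound (MulAction.orbitRel_apply.mpr ⟨ω, rfl⟩)
  have hne : q z ≠ q (τ z) := by
    intro h
    obtain ⟨ω, hω⟩ := MulAction.orbitRel_apply.mp (Quotient.exact h.symm)
    have hω : ω • z = τ z := hω
    obtain ⟨μ, hμ⟩ : ∃ μ : Circle, μ * μ = ω :=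
      ⟨Circle.exp (Complex.arg ω / 2), by rw [← Circle.exp_add, add_halves, Circle.exp_arg]⟩
    refine hz ⟨μ⁻¹, μ • z, ?_, by rw [inv_smul_smul]⟩
    rw [hτsmul, ← hω, ← hμ, mul_smul, inv_smul_smul]
  obtain ⟨g, h0, h1, -⟩ := exists_continuous_zero_one_of_isClosed
    (isClosed_singleton (x := q z)) (isClosed_singleton (x := q (τ z)))
    (Set.disjoint_singleton.mpr hne)
  refine ⟨⟨fun y => ((g (q y) : ℝ) : ℂ), by fun_prop⟩, fun ω y => ?_, ?_⟩
  · simp [hinv]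
  · have a : g (q z) = 0 := h0 rfl
    have b : g (q (τ z)) = 1 := h1 rfl
    simp [a, b]
end
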